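/- arXiv:1707.02954 — 2 statements merged into one kernel-verified Lean document; each statement's English description precedes it below -/
import Mathlib

section
/- Let $A$ be an abelian group and let $(F, \Omega)$ be a normalized abelian 3-cocycle on $A$ with values in $\mathbb{C}^\times$, i.e., maps $F : A^3 \to \mathbb{C}^\times$ and $\Omega : A^2 \to \mathbb{C}^\times$ satisfying: (pentagon) $F(i,j,k)F(i,j+k,\ell)F(j,k,\ell) = F(i+j,k,\ell)F(i,j,k+\ell)$; (hexagon 1) $F(i,j,k)^{-1}\Omega(i,j+k)F(j,k,i)^{-1} = \Omega(i,j)F(j,i,k)^{-1}\Omega(i,k)$; (hexagon 2) $F(i,j,k)\Omega(i+j,k)F(k,i,j) = \Omega(j,k)F(i,k,j)\Omega(i,k)$; and (normalization) $F(i,j,0)=F(i,0,k)=F(0,j,k)=1$ and $\Omega(i,0)=\Omega(0,j)=1$, for all $i,j,k,\ell \in A$. Then the trace $q : A \to \mathbb{C}^\times$ defined by $q(a) = \Omega(a,a)$ is a quadratic function: $q(ka) = q(a)^{k^2}$ for all integers $k$ (in particular $q(-a) = q(a)$), and the polarization $B(a,b) := q(a+b)\,q(a)^{-1}q(b)^{-1}$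 is symmetric and biadditive, i.e., $B(a,b) = B(b,a)$ and $B(a+b,c) = B(a,c)B(b,c)$ for all $a,b,c \in A$. -/
theorem em_polar {A G : Type*} [AddCommGroup A] [AddCommGroup G]
    (F : A → A → A → G) (Ω : A → A → G)
    (pent : ∀ i j k l : A,
      F i j k + F i (j + k) l + F j k l = F (i + j) k l + F i j (k + l))
    (hex1 : ∀ i j k : A,
      -(F i j k) + Ω i (j + k) + -(F j k i) = Ω i j + -(F j i k) + Ω i k)
    (hex2 : ∀ i j k : A,
      F i j k + Ω (i + j) k + F k i j = Ω j k + F i k j + Ω i k) (a b : A) :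
    Ω (a + b) (a + b) = Ω a a + Ω b b + (Ω a b + Ω b a) := by
  have h1 := hex2 a b (a + b)
  have h2 := hex1 b a b
  have h3 := hex1 a a b
  have h4 := pent a b a b
  rw [add_comm b a] at h4
  linear_combination (norm := module) h1 + h2 + h3 + h4

theorem em_bilin {A G : Type*} [AddCommGroup A] [AddCommGroup G]
    (F : A → A → A → G) (Ω : A → A → G)
    (hex1 : ∀ i j k : A,
      -(F i j k) + Ω i (j + k) + -(F j k i) = Ω i j + -(F j i k) + Ω i k)
    (hex2 : ∀ i j k : A,
      F i j k + Ω (i + j) k + F k i j = Ω j k + F i k j + Ω i k) (a b c : A) :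
    Ω (a + b) c + Ω c (a + b) = (Ω a c + Ω c a) + (Ω b c + Ω c b) := by
  linear_combination (norm := module) hex1 c a b + hex2 a b c

theorem em_main {A G : Type*} [AddCommGroup A] [AddCommGroup G]
    (F : A → A → A → G) (Ω : A → A → G)
    (pent : ∀ i j k l : A,
      F i j k + F i (j + k) l + F j k l = F (i + j) k l + F i j (k + l))
    (hex1 : ∀ i j k : A,
      -(F i j k) + Ω i (j + k) + -(F j k i) = Ω i j + -(F j i k) + Ω i k)
    (hex2 : ∀ i j k : A,
      F i j k + Ω (i + j) k + F k i j = Ω j k + F i k j + Ω i k)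
    (normΩ : ∀ i j : A, Ω i 0 = 0 ∧ Ω 0 j = 0) :
    (∀ (k : ℤ) (a : A), Ω (k • a) (k • a) = (k ^ 2) • Ω a a)
    ∧ (∀ a b c : A,
        Ω (a + b + c) (a + b + c) + -(Ω (a + b) (a + b)) + -(Ω c c)
          = (Ω (a + c) (a + c) + -(Ω a a) + -(Ω c c))
              + (Ω (b + c) (b + c) + -(Ω b b) + -(Ω c c))) := by
  have P := em_polar F Ω pent hex1 hex2
  have B := em_bilin F Ω hex1 hex2
  refine ⟨fun k a => ?_, fun a b c => ?_⟩
  · let f : A →+ G := AddMonoidHom.mk' (fun x => Ω x a + Ω a x) (fun x y => B x y a)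
    have hM : ∀ n : ℤ, Ω (n • a) a + Ω a (n • a) = n • (Ω a a + Ω a a) :=
      fun n => map_zsmul f n a
    have step : ∀ n : ℤ, Ω ((n + 1) • a) ((n + 1) • a)
        = Ω (n • a) (n • a) + Ω a a + n • (Ω a a + Ω a a) := by
      intro n
      rw [add_smul, one_smul, P, hM]
    induction k using Int.induction_on with
    | zero => simp [(normΩ 0 0).1]
    | succ n ih =>
      rw [step, ih]; module
    | pred n ih =>
      have h := step (-(n : ℤ) - 1)
      rw [sub_add_cancel, ih] at h
      linear_combination (norm := module) -h
  · rw [P (a + b) c, P a c, P b c]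
    linear_combination (norm := module) B a b c

/-- The trace `q(a) = Ω(a,a)` of a normalized abelian 3-cocycle `(F, Ω)` on an abelian
group `A` with values in `ℂˣ` is a quadratic function: `q(k • a) = q(a)^(k²)` for all
integers `k` (in particular `q(-a) = q(a)`), and its polarization
`B(a,b) = q(a+b) q(a)⁻¹ q(b)⁻¹` is symmetric and biadditive. -/
theorem stmt3 {A : Type*} [AddCommGroup A]
    (F : A → A → A → ℂˣ) (Ω : A → A → ℂˣ)
    (pent : ∀ i j k l : A,
      F i j k * F i (j + k) l * F j k l = F (i + j) k l * F i j (k + l))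
    (hex1 : ∀ i j k : A,
      (F i j k)⁻¹ * Ω i (j + k) * (F j k i)⁻¹ = Ω i j * (F j i k)⁻¹ * Ω i k)
    (hex2 : ∀ i j k : A,
      F i j k * Ω (i + j) k * F k i j = Ω j k * F i k j * Ω i k)
    (normF : ∀ i j k : A, F i j 0 = 1 ∧ F i 0 k = 1 ∧ F 0 j k = 1)
    (normΩ : ∀ i j : A, Ω i 0 = 1 ∧ Ω 0 j = 1) :
    (∀ (k : ℤ) (a : A), Ω (k • a) (k • a) = Ω a a ^ (k ^ 2))
    ∧ (∀ a : A, Ω (-a) (-a) = Ω a a)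
    ∧ (∀ a b : A,
        Ω (a + b) (a + b) * (Ω a a)⁻¹ * (Ω b b)⁻¹
          = Ω (b + a) (b + a) * (Ω b b)⁻¹ * (Ω a a)⁻¹)
    ∧ (∀ a b c : A,
        Ω (a + b + c) (a + b + c) * (Ω (a + b) (a + b))⁻¹ * (Ω c c)⁻¹
          = (Ω (a + c) (a + c) * (Ω a a)⁻¹ * (Ω c c)⁻¹)
              * (Ω (b + c) (b + c) * (Ω b b)⁻¹ * (Ω c c)⁻¹)) := by
  obtain ⟨h1, h2⟩ := em_main (G := Additive ℂˣ) F Ω pent hex1 hex2 normΩ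
  have h1' : ∀ (k : ℤ) (a : A), Ω (k • a) (k • a) = Ω a a ^ (k ^ 2) := h1
  refine ⟨h1', fun a => ?_, fun a b => ?_, h2⟩
  · simpa using h1' (-1) a
  · rw [add_comm b a, mul_right_comm]
end

section
/- Let $G$ be a finite group, let $\mathfrak{H}$ be the complex upper half-plane, and let $f$ be a function assigning to each commuting pair $(g,h) \in G \times G$ a function $f(g,h;-) : \mathfrak{H} \to \mathbb{C}$, and suppose $f$ satisfies the equivariance rule $f(g^a h^c, g^b h^d; \tau) = f\big(g,h; \tfrac{a\tau+b}{c\tau+d}\big)$ for every matrix $\left(\begin{smallmatrix} a & b \\ c & d \end{smallmatrix}\right) \in SL_2(\mathbb{Z})$, every commuting pair $(g,h)$, and every $\tau \in \mathfrak{H}$. For an integer $m \geq 1$, define the equivariant Hecke operator $T_m$ by $(T_m f)(g,h;\tau) = \frac{1}{m} \sum_{\substack{ad = m,\ a,d > 0 \\ 0 \leq b < d}} f\big(g^d, g^{-b} h^a; \tfrac{a\tau + b}{d}\big)$. Then $T_m f$ satisfies the same equivariance rule: $(T_m f)(g^a h^c, g^b h^d; \tau) = (T_m f)\big(g,h; \tfrac{a\tau+b}{c\tau+d}\big)$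 for all $\left(\begin{smallmatrix} a & b \\ c & d \end{smallmatrix}\right) \in SL_2(\mathbb{Z})$ and all commuting pairs $(g,h)$. -/
/-- The point `(aτ + b)/d` of the upper half-plane, for positive integers `a, d`. -/
noncomputable def mkPt (a b d : ℕ) (ha : 0 < a) (hd : 0 < d) (τ : UpperHalfPlane) :
    UpperHalfPlane :=
  ⟨((a : ℂ) * (τ : ℂ) + (b : ℂ)) / (d : ℂ), by
    have h1 : (((a : ℂ) * (τ : ℂ) + (b : ℂ)) / (d : ℂ)).im = (a : ℝ) * τ.im / (d : ℝ) := by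
      rw [show ((d : ℕ) : ℂ) = (((d : ℕ) : ℝ) : ℂ) by push_cast; ring, Complex.div_ofReal_im]
      congr 1
      simp [Complex.add_im, Complex.mul_im, UpperHalfPlane.coe_im]
    rw [h1]
    exact div_pos (mul_pos (by exact_mod_cast ha) τ.im_pos) (by exact_mod_cast hd)⟩

/-- The `m`-th equivariant Hecke operator:
`(T_m f)(g,h;τ) = (1/m) ∑_{ad = m, 0 ≤ b < d} f(gᵈ, g⁻ᵇhᵃ; (aτ+b)/d)`. -/
noncomputable def heckeOp {G : Type*} [Group G] (m : ℕ) (hm : 0 < m)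
    (f : G → G → UpperHalfPlane → ℂ) (g h : G) (τ : UpperHalfPlane) : ℂ :=
  (m : ℂ)⁻¹ *
    ∑ a ∈ m.divisors.attach, ∑ b ∈ Finset.range (m / a.1),
      f (g ^ (m / a.1)) (g ^ (-(b : ℤ)) * h ^ a.1)
        (mkPt a.1 b (m / a.1) (Nat.pos_of_mem_divisors a.2)
          (Nat.div_pos (Nat.le_of_dvd hm (Nat.dvd_of_mem_divisors a.2))
            (Nat.pos_of_mem_divisors a.2)) τ)

/-- Integral matrices of determinant `m`. -/
abbrev HMat (m : ℕ) := FixedDetMatrix (Fin 2) ℤ (m : ℤ)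

/-- The image in `GL(2, ℝ)` of an integral matrix of determinant `m`. -/
noncomputable def hGL (m : ℕ) (hm : 0 < m) (A : HMat m) : GL (Fin 2) ℝ :=
  Matrix.GeneralLinearGroup.mkOfDetNeZero (A.1.map (Int.cast : ℤ → ℝ)) (by
    have h : (A.1.map (Int.cast : ℤ → ℝ)).det = ((A.1.det : ℤ) : ℝ) :=
      ((Int.castRingHom ℝ).map_det A.1).symm
    rw [h, A.2]
    exact_mod_cast hm.ne')

lemma hGL_det (m : ℕ) (hm : 0 < m) (A : HMat m) : 0 < (hGL m hm A).det.val := by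
  have h : (A.1.map (Int.cast : ℤ → ℝ)).det = ((A.1.det : ℤ) : ℝ) :=
      ((Int.castRingHom ℝ).map_det A.1).symm
  change 0 < (A.1.map (Int.cast : ℤ → ℝ)).det
  rw [h, A.2]
  exact_mod_cast hm

/-- Right multiplication by an element of `SL(2, ℤ)`. -/
def hRight (m : ℕ) (γ : Matrix.SpecialLinearGroup (Fin 2) ℤ) (A : HMat m) : HMat m :=
  ⟨A.1 * γ.1, by rw [Matrix.det_mul, A.2, γ.2, mul_one]⟩

lemma hGL_smul (m : ℕ) (hm : 0 < m) (γ : Matrix.SpecialLinearGroup (Fin 2) ℤ) (A : HMat m)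
    (τ : UpperHalfPlane) : hGL m hm (γ • A) • τ = γ • (hGL m hm A • τ) := by
  have h : hGL m hm (γ • A) = Matrix.SpecialLinearGroup.mapGL ℝ γ * hGL m hm A := by
    ext i j
    change (((γ.1 * A.1) i j : ℤ) : ℝ) = ((Matrix.SpecialLinearGroup.mapGL ℝ γ).val *
      (A.1.map (Int.cast : ℤ → ℝ))) i j
    simp [Matrix.mul_apply]
  rw [h, mul_smul]
  rfl

lemma hGL_right (m : ℕ) (hm : 0 < m) (γ : Matrix.SpecialLinearGroup (Fin 2) ℤ) (A : HMat m)
    (τ : UpperHalfPlane) : hGL m hm (hRight m γ A) • τ = hGL m hm A • (γ • τ) := by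
  have h : hGL m hm (hRight m γ A) = hGL m hm A * Matrix.SpecialLinearGroup.mapGL ℝ γ := by
    ext i j
    change (((A.1 * γ.1) i j : ℤ) : ℝ) = ((A.1.map (Int.cast : ℤ → ℝ)) *
      (Matrix.SpecialLinearGroup.mapGL ℝ γ).val) i j
    simp [Matrix.mul_apply]
  rw [h, mul_smul]
  rfl

lemma comb {G : Type*} [Group G] {g h : G} (c : Commute g h) (p q r s x y : ℤ) :
    (g ^ p * h ^ q) ^ x * (g ^ r * h ^ s) ^ y = g ^ (p * x + r * y) * h ^ (q * x + s * y) := by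
  rw [((c.zpow_zpow p q)).mul_zpow, ((c.zpow_zpow r s)).mul_zpow, ← zpow_mul, ← zpow_mul,
    ← zpow_mul, ← zpow_mul, zpow_add, zpow_add]
  have := (c.zpow_zpow (r * y) (q * x)).eq
  simp only [mul_assoc]
  rw [← mul_assoc (h ^ (q * x)), ← this, mul_assoc]

lemma comb_comm {G : Type*} [Group G] {g h : G} (c : Commute g h) (p q r s : ℤ) :
    Commute (g ^ p * h ^ q) (g ^ r * h ^ s) := by
  have h1 := comb c p q r s 1 1
  have h2 := comb c r s p q 1 1
  simp only [zpow_one, mul_one] at h1 h2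
  change _ * _ = _ * _
  rw [h1, h2, add_comm r, add_comm s]

/-- The summand attached to a matrix. -/
noncomputable def hF {G : Type*} [Group G] (m : ℕ) (hm : 0 < m)
    (f : G → G → UpperHalfPlane → ℂ) (g h : G) (τ : UpperHalfPlane) (A : HMat m) : ℂ :=
  f (g ^ (A.1 1 1) * h ^ (-A.1 1 0)) (g ^ (-A.1 0 1) * h ^ (A.1 0 0)) (hGL m hm A • τ)

lemma hF_smul {G : Type*} [Group G] (m : ℕ) (hm : 0 < m)
    (f : G → G → UpperHalfPlane → ℂ)
    (hf : ∀ γ : Matrix.SpecialLinearGroup (Fin 2) ℤ, ∀ g h : G, Commute g h →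
      ∀ τ : UpperHalfPlane,
        f (g ^ (γ.1 0 0) * h ^ (γ.1 1 0)) (g ^ (γ.1 0 1) * h ^ (γ.1 1 1)) τ
          = f g h (γ • τ))
    (g h : G) (c : Commute g h) (τ : UpperHalfPlane)
    (γ : Matrix.SpecialLinearGroup (Fin 2) ℤ) (A : HMat m) :
    hF m hm f g h τ (γ • A) = hF m hm f g h τ A := by
  have hd := γ.2
  rw [Matrix.det_fin_two] at hd
  unfold hF
  rw [hGL_smul, ← hf γ _ _ (comb_comm c _ _ _ _), comb c, comb c, FixedDetMatrices.smul_coe]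
  simp only [Matrix.mul_apply, Fin.sum_univ_two]
  congr 2
  · congr 1
    linear_combination (A.1 1 1) * hd
  · congr 1
    linear_combination (-A.1 1 0) * hd
  · congr 1
    linear_combination (-A.1 0 1) * hd
  · congr 1
    linear_combination (A.1 0 0) * hd

lemma hF_right {G : Type*} [Group G] (m : ℕ) (hm : 0 < m)
    (f : G → G → UpperHalfPlane → ℂ)
    (g h : G) (c : Commute g h) (τ : UpperHalfPlane)
    (γ : Matrix.SpecialLinearGroup (Fin 2) ℤ) (A : HMat m) :
    hF m hm f (g ^ (γ.1 0 0) * h ^ (γ.1 1 0)) (g ^ (γ.1 0 1) * h ^ (γ.1 1 1)) τ (hRight m γ A)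
      = hF m hm f g h (γ • τ) A := by
  have hd := γ.2
  rw [Matrix.det_fin_two] at hd
  unfold hF
  rw [hGL_right, comb c, comb c]
  simp only [hRight, Matrix.mul_apply, Fin.sum_univ_two]
  congr 2
  · congr 1
    linear_combination (A.1 1 1) * hd
  · congr 1
    linear_combination (-A.1 1 0) * hd
  · congr 1
    linear_combination (-A.1 0 1) * hd
  · congr 1
    linear_combination (A.1 0 0) * hd

/-- Index type of the Hecke sum. -/
abbrev HIdx (m : ℕ) := Σ a : {x // x ∈ m.divisors}, Fin (m / a.1)

/-- The upper triangular representative. -/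
def hRep (m : ℕ) (i : HIdx m) : HMat m :=
  ⟨!![(i.1.1 : ℤ), (i.2.1 : ℤ); 0, ((m / i.1.1 : ℕ) : ℤ)], by
    rw [Matrix.det_fin_two_of, mul_zero, sub_zero]
    exact_mod_cast Nat.mul_div_cancel' (Nat.dvd_of_mem_divisors i.1.2)⟩

lemma heckeOp_eq {G : Type*} [Group G] (m : ℕ) (hm : 0 < m)
    (f : G → G → UpperHalfPlane → ℂ) (g h : G) (τ : UpperHalfPlane) :
    heckeOp m hm f g h τ = (m : ℂ)⁻¹ * ∑ i : HIdx m, hF m hm f g h τ (hRep m i) := by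
  unfold heckeOp
  rw [Fintype.sum_sigma, ← Finset.univ_eq_attach]
  congr 1
  refine Finset.sum_congr rfl fun a _ => ?_
  rw [Finset.sum_fin_eq_sum_range]
  refine Finset.sum_congr rfl fun b hb => ?_
  rw [dif_pos (Finset.mem_range.mp hb)]
  unfold hF
  congr 1
  · simp [hRep, -Nat.cast_div, -Int.natCast_ediv]
  · simp [hRep]
  · ext
    rw [UpperHalfPlane.coe_smul_of_det_pos (hGL_det _ _ _)]
    simp [mkPt, UpperHalfPlane.num, UpperHalfPlane.denom, hGL, hRep,
      Matrix.GeneralLinearGroup.mkOfDetNeZero, -Nat.cast_div, -Int.natCast_ediv]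

/-- Orbits of `SL(2, ℤ)` acting on the left. -/
abbrev HQ (m : ℕ) := MulAction.orbitRel.Quotient (Matrix.SpecialLinearGroup (Fin 2) ℤ) (HMat m)

lemma hRep_inj (m : ℕ) (i j : HIdx m) (γ : Matrix.SpecialLinearGroup (Fin 2) ℤ)
    (h : γ • hRep m i = hRep m j) : i = j := by
  obtain ⟨⟨a, ha⟩, ⟨b, hb⟩⟩ := i
  obtain ⟨⟨a', ha'⟩, ⟨b', hb'⟩⟩ := j
  have h1 := congrArg Subtype.val h
  rw [FixedDetMatrices.smul_coe] at h1
  have e00 := congrFun (congrFun h1 0) 0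
  have e01 := congrFun (congrFun h1 0) 1
  have e10 := congrFun (congrFun h1 1) 0
  have e11 := congrFun (congrFun h1 1) 1
  simp [hRep, Matrix.mul_apply, Fin.sum_univ_two, -Nat.cast_div, -Int.natCast_ediv] at e00 e01 e10 e11
  have hp : (0 : ℤ) < a := by exact_mod_cast Nat.pos_of_mem_divisors ha
  have hp' : (0 : ℤ) < a' := by exact_mod_cast Nat.pos_of_mem_divisors ha'
  have hd := γ.2
  rw [Matrix.det_fin_two] at hd
  have hc : γ.1 1 0 = 0 := by
    rcases e10 with h | h
    · exact h
    · have := Nat.pos_of_mem_divisors ha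
      omega
  simp only [hc, mul_zero, sub_zero] at hd
  have h0 : γ.1 0 0 = 1 := by
    rcases Int.mul_eq_one_iff_eq_one_or_neg_one.mp hd with ⟨h, _⟩ | ⟨h, _⟩
    · exact h
    · rw [h] at e00; linarith
  rw [h0] at e00 e01
  have : a = a' := by exact_mod_cast (by linarith : (a : ℤ) = a')
  subst this
  simp only at hb hb'
  have hbb : b = b' := by
    clear h h1 e11
    generalize m / a = d at *
    have h2 : γ.1 0 1 = 0 := by
      by_contra hne
      rcases lt_or_gt_of_ne hne with h | h
      · have : γ.1 0 1 * (d : ℤ) ≤ -1 * d := by gcongr; omega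
        omega
      · have : 1 * (d : ℤ) ≤ γ.1 0 1 * d := by gcongr; omega
        omega
    rw [h2] at e01
    omega
  subst hbb
  rfl

lemma hRep_surj (m : ℕ) (hm : 0 < m) (A : HMat m) :
    ∃ i, ∃ γ : Matrix.SpecialLinearGroup (Fin 2) ℤ, γ • hRep m i = A := by
  have hm' : (m : ℤ) ≠ 0 := by exact_mod_cast hm.ne'
  induction A using FixedDetMatrices.induction_on hm' with
  | h0 A h10 h00 h01 h11 =>
    have hd := A.2
    rw [Matrix.det_fin_two, h10, mul_zero, sub_zero] at hd
    have hmp : (0 : ℤ) < m := by exact_mod_cast hm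
    have hdp : 0 < A.1 1 1 := by
      rw [← hd] at hmp
      exact (pos_iff_pos_of_mul_pos hmp).mp h00
    rw [abs_of_nonneg h01, abs_of_pos hdp] at h11
    obtain ⟨a, ha⟩ := Int.eq_ofNat_of_zero_le h00.le
    obtain ⟨b, hb⟩ := Int.eq_ofNat_of_zero_le h01
    obtain ⟨d, hd'⟩ := Int.eq_ofNat_of_zero_le hdp.le
    have had : a * d = m := by rw [ha, hd'] at hd; exact_mod_cast hd
    have hap : 0 < a := by omega
    have hdd : m / a = d := by rw [← had, Nat.mul_div_cancel_left _ hap]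
    refine ⟨⟨⟨a, Nat.mem_divisors.mpr ⟨⟨d, had.symm⟩, hm.ne'⟩⟩, ⟨b, ?_⟩⟩, 1, ?_⟩
    · simp only [hdd]; omega
    · rw [one_smul]
      ext i j
      fin_cases i <;> fin_cases j <;>
        simp [hRep, hdd, ha, hb, hd', h10, -Nat.cast_div, -Int.natCast_ediv]
  | hS B h =>
    obtain ⟨i, γ, h⟩ := h
    exact ⟨i, ModularGroup.S * γ, by rw [mul_smul, h]⟩
  | hT B h =>
    obtain ⟨i, γ, h⟩ := h
    exact ⟨i, ModularGroup.T * γ, by rw [mul_smul, h]⟩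

/-- Representatives are in bijection with orbits. -/
noncomputable def hEquiv (m : ℕ) (hm : 0 < m) : HIdx m ≃ HQ m :=
  Equiv.ofBijective (fun i => (Quotient.mk _ (hRep m i) : HQ m)) (by
    constructor
    · intro i j h
      obtain ⟨γ, h⟩ := Quotient.exact h
      exact (hRep_inj m j i γ h).symm
    · intro q
      induction q using Quotient.inductionOn with
      | h A =>
        obtain ⟨i, γ, h⟩ := hRep_surj m hm A
        refine ⟨i, Quotient.sound ?_⟩
        exact ⟨γ⁻¹, by simp [← h]⟩)

lemma hRight_smul (m : ℕ) (γ δ : Matrix.SpecialLinearGroup (Fin 2) ℤ) (A : HMat m) :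
    hRight m γ (δ • A) = δ • hRight m γ A := by
  apply FixedDetMatrices.ext'
  rw [FixedDetMatrices.smul_coe]
  simp only [hRight, FixedDetMatrices.smul_coe, mul_assoc]

lemma hRight_hRight (m : ℕ) (γ δ : Matrix.SpecialLinearGroup (Fin 2) ℤ) (h : γ * δ = 1)
    (A : HMat m) : hRight m δ (hRight m γ A) = A := by
  apply FixedDetMatrices.ext'
  have := congrArg Subtype.val h
  simp only [hRight, mul_assoc]
  change γ.1 * δ.1 = 1 at this
  rw [this, mul_one]

/-- Right multiplication on orbits. -/
def hMap (m : ℕ) (γ : Matrix.SpecialLinearGroup (Fin 2) ℤ) : HQ m → HQ m :=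
  Quotient.map (hRight m γ) (by
    rintro A B ⟨δ, h⟩
    exact ⟨δ, by simp only [← hRight_smul]; exact congrArg _ h⟩)

/-- Right multiplication on orbits, as a permutation. -/
def hPerm (m : ℕ) (γ : Matrix.SpecialLinearGroup (Fin 2) ℤ) : HQ m ≃ HQ m where
  toFun := hMap m γ
  invFun := hMap m γ⁻¹
  left_inv q := by
    induction q using Quotient.inductionOn with
    | h A => exact congrArg _ (hRight_hRight m γ γ⁻¹ (mul_inv_cancel γ) A)
  right_inv q := by
    induction q using Quotient.inductionOn with
    | h A => exact congrArg _ (hRight_hRight m γ⁻¹ γ (inv_mul_cancel γ) A)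

/-- If `f`, defined on commuting pairs in a finite group `G`, satisfies the `SL₂(ℤ)`
equivariance rule `f(gᵃhᶜ, gᵇhᵈ; τ) = f(g,h; (aτ+b)/(cτ+d))`, then so does `T_m f`. -/
theorem stmt9 {G : Type*} [Group G] [Finite G]
    (f : G → G → UpperHalfPlane → ℂ)
    (hf : ∀ γ : Matrix.SpecialLinearGroup (Fin 2) ℤ, ∀ g h : G, Commute g h →
      ∀ τ : UpperHalfPlane,
        f (g ^ (γ.1 0 0) * h ^ (γ.1 1 0)) (g ^ (γ.1 0 1) * h ^ (γ.1 1 1)) τ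
          = f g h (γ • τ))
    (m : ℕ) (hm : 0 < m) :
    ∀ γ : Matrix.SpecialLinearGroup (Fin 2) ℤ, ∀ g h : G, Commute g h →
      ∀ τ : UpperHalfPlane,
        heckeOp m hm f (g ^ (γ.1 0 0) * h ^ (γ.1 1 0)) (g ^ (γ.1 0 1) * h ^ (γ.1 1 1)) τ
          = heckeOp m hm f g h (γ • τ) := by
  intro γ g h c τ
  rw [heckeOp_eq, heckeOp_eq]
  congr 1
  have key : ∀ (g h : G) (_ : Commute g h) (τ : UpperHalfPlane) (A B : HMat m),
      (Quotient.mk _ A : HQ m) = Quotient.mk _ B → hF m hm f g h τ A = hF m hm f g h τ B := by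
    intro g h c τ A B hq
    obtain ⟨δ, hδ⟩ := Quotient.exact hq
    rw [← hδ]
    exact hF_smul m hm f hf g h c τ δ B
  let e : HIdx m ≃ HIdx m := ((hEquiv m hm).trans (hPerm m γ)).trans (hEquiv m hm).symm
  rw [← Equiv.sum_comp e]
  refine Finset.sum_congr rfl fun i _ => ?_
  rw [← hF_right m hm f g h c τ γ (hRep m i)]
  refine key _ _ (comb_comm c _ _ _ _) τ _ _ ?_
  exact (hEquiv m hm).apply_symm_apply (hPerm m γ (hEquiv m hm i))
end
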